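/- Let F ≥ 2 and D be natural numbers. The one-cast probability p is strictly antitone on the positive ball of radius D if and only if D < F; that is, (∀ d d' : Fin F → ℕ, d ≤ d' → d ≠ d' → |d'| ≤ D → p(d') < p(d)) ↔ D < F. -/

import Mathlib

open Finset

/-- The one-cast probability of the combination `d : Fin F → ℕ` (multinomial law):
`p(d) = |d|! / (∏ f, (d f)! · F^{|d|})` where `|d| = ∑ f, d f`. -/
def oneCastProb (F : ℕ) (d : Fin F → ℕ) : ℚ :=
  (Nat.factorial (∑ f, d f) : ℚ) /
    ((∏ f, Nat.factorial (d f) : ℕ) * (F : ℚ) ^ (∑ f, d f))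

lemma prod_factorial_add_single {F : ℕ} (d : Fin F → ℕ) (f : Fin F) :
    ∏ g, Nat.factorial ((d + Pi.single f 1 : Fin F → ℕ) g) = (d f + 1) * ∏ g, Nat.factorial (d g) := by
  rw [← Finset.mul_prod_erase _ _ (Finset.mem_univ f),
    ← Finset.mul_prod_erase _ (fun g => Nat.factorial (d g)) (Finset.mem_univ f), ← mul_assoc]
  congr 1
  · simp [Nat.factorial_succ]
  · refine Finset.prod_congr rfl fun g hg => ?_
    simp [Pi.single_eq_of_ne (Finset.ne_of_mem_erase hg)]

lemma sum_add_single_one {F : ℕ} (d : Fin F → ℕ) (f : Fin F) :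
    ∑ g, (d + Pi.single f 1 : Fin F → ℕ) g = ∑ g, d g + 1 := by
  simp [Finset.sum_add_distrib]

lemma oneCastProb_pos {F : ℕ} (hF : 0 < F) (d : Fin F → ℕ) : 0 < oneCastProb F d := by
  have h : 0 < ∏ f, Nat.factorial (d f) := Finset.prod_pos fun f _ => Nat.factorial_pos _
  unfold oneCastProb
  positivity

/-- Adding one die showing `f` multiplies the probability by `(|d| + 1) / ((d f + 1) F)`. -/
lemma oneCastProb_add_single {F : ℕ} (d : Fin F → ℕ) (f : Fin F) :
    oneCastProb F (d + Pi.single f 1) =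
      oneCastProb F d * (((∑ g, d g : ℕ) + 1) / ((d f + 1) * F)) := by
  unfold oneCastProb
  rw [sum_add_single_one, prod_factorial_add_single, Nat.factorial_succ, pow_succ,
    Nat.cast_mul (d f + 1), Nat.cast_mul (_ + 1), Nat.cast_succ, Nat.cast_succ, div_mul_div_comm]
  congr 1 <;> ring

lemma oneCastProb_add_single_lt {F : ℕ} (d : Fin F → ℕ) (f : Fin F) (h : ∑ g, d g + 1 < F) :
    oneCastProb F (d + Pi.single f 1) < oneCastProb F d := by
  have hF : 0 < F := by omega
  rw [oneCastProb_add_single]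
  refine mul_lt_of_lt_one_right (oneCastProb_pos hF d) ?_
  rw [div_lt_one (by positivity)]
  have h' : ((∑ g, d g : ℕ) + 1 : ℚ) < F := by exact_mod_cast h
  have : (0 : ℚ) ≤ d f * F := by positivity
  linarith

lemma oneCastProb_lt_of_lt {F : ℕ} {d d' : Fin F → ℕ} (hlt : d < d') (h : ∑ g, d' g < F) :
    oneCastProb F d' < oneCastProb F d := by
  obtain ⟨k, hk⟩ : ∃ k, ∑ g, d' g = ∑ g, d g + k :=
    Nat.exists_eq_add_of_le (Finset.sum_le_sum fun g _ => hlt.le g)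
  induction k generalizing d with
  | zero =>
    obtain ⟨hle, f, hf⟩ := Pi.lt_def.1 hlt
    have := Finset.sum_lt_sum (fun g _ => hle g) ⟨f, Finset.mem_univ f, hf⟩
    omega
  | succ k ih =>
    obtain ⟨hle, f, hf⟩ := Pi.lt_def.1 hlt
    have hstep := oneCastProb_add_single_lt d f (by omega)
    have hle' : d + Pi.single f 1 ≤ d' := by
      intro g
      by_cases hg : g = f
      · subst hg
        simpa using hf
      · simpa [hg] using hle g
    rcases hle'.eq_or_lt with heq | hlt'
    · rwa [← heq]
    · exact (ih hlt' (by rw [sum_add_single_one]; omega)).trans hstep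

/-- For `F ≥ 2`, the one-cast probability `p` is strictly antitone on the
positive ball `B⁺(D)` if and only if `D < F`. -/
theorem stmt_5 (F D : ℕ) (hF : 2 ≤ F) :
    (∀ d d' : Fin F → ℕ, d ≤ d' → d ≠ d' → (∑ f, d' f) ≤ D →
      oneCastProb F d' < oneCastProb F d) ↔ D < F := by
  constructor
  · intro h
    by_contra! hD
    have hF0 : 0 < F := by omega
    let f : Fin F := ⟨0, hF0⟩
    let d : Fin F → ℕ := fun g => if g = f then 0 else 1
    have hone : d + Pi.single f 1 = 1 := by
      ext g
      by_cases hg : g = f <;> simp [d, hg]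
    have hsum : ∑ g, d g + 1 = F := by
      rw [← sum_add_single_one d f, hone]
      simp
    have hsum' : ((∑ g, d g : ℕ) + 1 : ℚ) = F := by exact_mod_cast hsum
    have hdf : d f = 0 := if_pos rfl
    have hlt := h d (d + Pi.single f 1) le_self_add (by simp)
      (by rw [sum_add_single_one]; omega)
    have hF' : (F : ℚ) ≠ 0 := by exact_mod_cast hF0.ne'
    rw [oneCastProb_add_single, hsum', hdf] at hlt
    simp [hF'] at hlt
  · intro hD d d' hle hne hsum
    exact oneCastProb_lt_of_lt (hle.lt_of_ne hne) (by omega)
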